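/- arXiv:2407.04664 — 10 statements merged into one kernel-verified Lean document; each statement's English description precedes it below -/
import Mathlib

section
/- Let ⟨N, H, V⟩ be a house allocation instance and let G be the bipartite graph on N ∪ H that has an edge (i, h) exactly when v_i(h) = max_{h'∈H} v_i(h') and v_i(h) > 0 (i.e., h is a positively-valued most preferred house of agent i). Suppose N' ⊆ N is an inclusion-minimal Hall-violating set of agents in G, i.e., |N_G(N')| < |N'| where N_G(N') is the set of houses adjacent in G to some agent of N', and no proper nonempty subset of N' is Hall-violating. Then in every envy-free allocation, no house of N_G(N') is assigned to any agent. -/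
open Finset
open scoped Classical

namespace HouseAlloc

variable {N H : Type*}

/-- The value agent `i` receives under allocation `A` (`0` if unassigned). -/
noncomputable def val (v : N → H → ℝ) (A : N → Option H) (i : N) : ℝ :=
  (A i).elim 0 (v i)

/-- `A` is an allocation: an injective partial map from agents to houses. -/
def Inj (A : N → Option H) : Prop :=
  ∀ i j h, A i = some h → A j = some h → i = j

/-- Agent `i` envies agent `j` under allocation `A`. -/
def Envies (v : N → H → ℝ) (A : N → Option H) (i j : N) : Prop :=
  (A i).elim 0 (v i) < (A j).elim 0 (v i)

/-- `A` is envy-free. -/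
def EF (v : N → H → ℝ) (A : N → Option H) : Prop :=
  ∀ i j, ¬ Envies v A i j

/-- Pairwise envy `envy_{i,j}(A) = max{v_i(A(j)) - v_i(A(i)), 0}`. -/
noncomputable def pairEnvy (v : N → H → ℝ) (A : N → Option H) (i j : N) : ℝ :=
  max ((A j).elim 0 (v i) - (A i).elim 0 (v i)) 0

/-- Total envy of agent `i`: `envy_i(A) = Σ_j envy_{i,j}(A)`. -/
noncomputable def agentEnvy [Fintype N] (v : N → H → ℝ) (A : N → Option H) (i : N) : ℝ :=
  ∑ j, pairEnvy v A i j

/-- Total envy of allocation `A`. -/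
noncomputable def totalEnvy [Fintype N] (v : N → H → ℝ) (A : N → Option H) : ℝ :=
  ∑ i, agentEnvy v A i

/-- Utilitarian social welfare `USW(A) = Σ_i v_i(A(i))`. -/
noncomputable def USW [Fintype N] (v : N → H → ℝ) (A : N → Option H) : ℝ :=
  ∑ i, (A i).elim 0 (v i)

/-- Number of envious agents `#envy(A)`. -/
noncomputable def numEnvious [Fintype N] (v : N → H → ℝ) (A : N → Option H) : ℕ :=
  (univ.filter fun i => ∃ j, Envies v A i j).card

/-- The size of `A`: the number of assigned agents. -/
noncomputable def size [Fintype N] (A : N → Option H) : ℕ :=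
  (univ.filter fun i => (A i).isSome = true).card

/-- `A` is complete (when `m ≤ n`): every house is assigned to some agent. -/
def Complete (A : N → Option H) : Prop :=
  ∀ h : H, ∃ i, A i = some h

/-- `A` is agent-saturating: every agent is assigned a house. -/
def Saturating (A : N → Option H) : Prop :=
  ∀ i, (A i).isSome = true

/-- `h` is a positively-valued most preferred house of agent `i`. -/
def Edge (v : N → H → ℝ) (i : N) (h : H) : Prop :=
  v i h = (⨆ h' : H, v i h') ∧ 0 < v i h

/-- Neighborhood in the graph of positively-valued most preferred houses. -/
noncomputable def nbr [Fintype H] (v : N → H → ℝ) (S : Finset N) : Finset H :=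
  univ.filter fun h => ∃ i ∈ S, Edge v i h

lemma mem_nbr [Fintype H] {v : N → H → ℝ} {S : Finset N} {h : H} :
    h ∈ nbr v S ↔ ∃ i ∈ S, Edge v i h := by
  simp [nbr]

/-- In an envy-free allocation, an agent one of whose most preferred houses is assigned
receives a most preferred house. -/
lemma EF.exists_edge [Finite H] {v : N → H → ℝ} {A : N → Option H} (hEF : EF v A)
    {i j : N} {h : H} (he : Edge v i h) (hj : A j = some h) :
    ∃ g, A i = some g ∧ Edge v i g := by
  have hle : v i h ≤ (A i).elim 0 (v i) := by
    simpa [Envies, hj] using hEF i j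
  cases hi : A i with
  | none =>
    rw [hi] at hle
    exact absurd he.2 (not_lt.mpr hle)
  | some g =>
    rw [hi] at hle
    have hle' : v i h ≤ v i g := hle
    refine ⟨g, rfl, le_antisymm (le_ciSup (Set.finite_range (v i)).bddAbove g) ?_,
      he.2.trans_le hle'⟩
    exact he.1 ▸ hle'

/-- If `N'` is an inclusion-minimal Hall-violating set of agents in the
graph of positively-valued most preferred houses, then no house in its neighborhood
is assigned in any envy-free allocation. -/
theorem stmt0 [Fintype N] [Fintype H]
    (v : N → H → ℝ) (hv : ∀ i h, 0 ≤ v i h)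
    (N' : Finset N)
    (hviol : (nbr v N').card < N'.card)
    (hmin : ∀ S : Finset N, S ⊂ N' → S.Nonempty → ¬ (nbr v S).card < S.card)
    (A : N → Option H) (hA : Inj A) (hEF : EF v A) :
    ∀ i h, h ∈ nbr v N' → A i ≠ some h := by
  intro j h hh hj
  let T := (nbr v N').filter fun g => ∃ k, A k = some g
  let S := N'.filter fun i => ∃ g ∈ T, Edge v i g
  have hS : ∀ i ∈ S, ∃ g, A i = some g ∧ Edge v i g := by
    intro i hi
    obtain ⟨-, g, hg, he⟩ := mem_filter.mp hi
    obtain ⟨-, k, hk⟩ := mem_filter.mp hg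
    exact hEF.exists_edge he hk
  have hcard : S.card ≤ T.card := by
    have : Nonempty H := ⟨h⟩
    choose! f hfA hfE using hS
    refine card_le_card_of_injOn f (fun i hi => ?_) (fun i hi k hk hik => ?_)
    · exact mem_filter.mpr
        ⟨mem_nbr.mpr ⟨i, (mem_filter.mp hi).1, hfE i hi⟩, i, hfA i hi⟩
    · exact hA i k (f i) (hfA i hi) (hik ▸ hfA k hk)
  have hsub : nbr v (N' \ S) ⊆ nbr v N' \ T := by
    intro g hg
    obtain ⟨i, hi, he⟩ := mem_nbr.mp hg
    obtain ⟨hiN, hiS⟩ := mem_sdiff.mp hi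
    exact mem_sdiff.mpr ⟨mem_nbr.mpr ⟨i, hiN, he⟩,
      fun hgT => hiS (mem_filter.mpr ⟨hiN, g, hgT, he⟩)⟩
  have hSN : S ⊆ N' := filter_subset _ _
  have hnbr := card_le_card hsub
  rw [card_sdiff_of_subset (filter_subset _ _)] at hnbr
  have hTle : T.card ≤ (nbr v N').card := card_le_card (filter_subset _ _)
  have hdiff := card_sdiff_of_subset hSN
  have hSne : S.Nonempty := by
    obtain ⟨i, hi, he⟩ := mem_nbr.mp hh
    exact ⟨i, mem_filter.mpr ⟨hi, h, mem_filter.mpr ⟨hh, j, hj⟩, he⟩⟩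
  have hlt : (nbr v (N' \ S)).card < (N' \ S).card := by
    change _ ≤ (nbr v N').card - T.card at hnbr
    omega
  exact hmin (N' \ S) (sdiff_ssubset hSN hSne) (card_pos.mp (by omega)) hlt

end HouseAlloc
end

section
/- For every house allocation instance ⟨N, H, V⟩ there exists an envy-free allocation A* such that for every envy-free allocation A one has |A*| ≥ |A| and USW(A*) ≥ USW(A); that is, some envy-free allocation simultaneously has maximum size and maximum utilitarian welfare among all envy-free allocations. -/
open Finset
open scoped Classical

namespace HouseAlloc

variable {N H : Type*}

/-- Every agent values its own house under `A` (or `0`) at least as much as each house of `K`, and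
`A` is an allocation of houses of `K`. -/
structure TopAlloc (v : N → H → ℝ) (K : Finset H) (A : N → Option H) : Prop where
  inj : Inj A
  mem : ∀ i h, A i = some h → h ∈ K
  top : ∀ i, ∀ h ∈ K, v i h ≤ (A i).elim 0 (v i)

/-- The positively-valued houses of `K` that agent `i` likes best among those of `K`. -/
noncomputable def favorites (v : N → H → ℝ) (K : Finset H) (i : N) : Finset H :=
  K.filter fun h => 0 < v i h ∧ ∀ h' ∈ K, v i h' ≤ v i h

/-- Every envy-free allocation uses only houses of `K`. -/
def ContainsEF (v : N → H → ℝ) (K : Finset H) : Prop :=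
  ∀ B : N → Option H, Inj B → EF v B → ∀ i h, B i = some h → h ∈ K

theorem elim_nonneg {v : N → H → ℝ} (hv : ∀ i h, 0 ≤ v i h) (i : N) (o : Option H) :
    0 ≤ o.elim 0 (v i) := by
  cases o with
  | none => exact le_rfl
  | some h => exact hv i h

theorem TopAlloc.elim_le {v : N → H → ℝ} (hv : ∀ i h, 0 ≤ v i h) {K : Finset H}
    {A : N → Option H} (hA : TopAlloc v K A) (i : N) {o : Option H} (ho : ∀ h, o = some h → h ∈ K) :
    o.elim 0 (v i) ≤ (A i).elim 0 (v i) := by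
  cases o with
  | none => exact elim_nonneg hv i _
  | some h => exact hA.top i h (ho h rfl)

theorem TopAlloc.ef {v : N → H → ℝ} (hv : ∀ i h, 0 ≤ v i h) {K : Finset H}
    {A : N → Option H} (hA : TopAlloc v K A) : EF v A :=
  fun i j => not_lt.2 (hA.elim_le hv i (hA.mem j))

theorem injOn_isSome [Fintype N] {A : N → Option H} (hA : Inj A) :
    Set.InjOn A (univ.filter fun i => (A i).isSome = true : Finset N) := by
  intro i hi j _ hij
  obtain ⟨h, hh⟩ := Option.isSome_iff_exists.1 (mem_filter.1 (mem_coe.1 hi)).2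
  exact hA i j h hh (hij ▸ hh)

theorem size_le_card [Fintype N] {A : N → Option H} (hA : Inj A) {K : Finset H}
    (hK : ∀ i h, A i = some h → h ∈ K) : size A ≤ K.card := by
  refine (card_le_card_of_injOn A (t := K.image some) ?_ (injOn_isSome hA)).trans card_image_le
  intro i hi
  obtain ⟨h, hh⟩ := Option.isSome_iff_exists.1 (mem_filter.1 (mem_coe.1 hi)).2
  rw [hh]
  exact mem_coe.2 (mem_image_of_mem _ (hK i h hh))

theorem size_le_card_agents [Fintype N] (A : N → Option H) : size A ≤ Fintype.card N :=
  card_le_univ _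

/-- A `TopAlloc` that leaves both an agent and a house of `K` unmatched can be enlarged. -/
theorem TopAlloc.exists_larger [Fintype N] {v : N → H → ℝ} (hv : ∀ i h, 0 ≤ v i h)
    {K : Finset H} {A : N → Option H} (hA : TopAlloc v K A) (hn : size A < Fintype.card N)
    (hK : size A < K.card) : ∃ A', TopAlloc v K A' ∧ size A < size A' := by
  obtain ⟨i, -, hi⟩ := exists_mem_notMem_of_card_lt_card (s := univ.filter fun i =>
    (A i).isSome = true) (t := univ) hn
  have hi : A i = none := by simpa using hi
  obtain ⟨o, ho, ho'⟩ := exists_mem_notMem_of_card_lt_card (s := (univ.filter fun i =>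
    (A i).isSome = true).image A) (t := K.image some) (by
      rw [card_image_of_injective _ (Option.some_injective H)]
      exact card_image_le.trans_lt hK)
  obtain ⟨h, hh, rfl⟩ := mem_image.1 ho
  have hfree : ∀ j, A j ≠ some h := fun j hj =>
    ho' (mem_image.2 ⟨j, by simp [hj], hj⟩)
  refine ⟨Function.update A i (some h), ⟨?_, ?_, ?_⟩, ?_⟩
  · intro j k g hj hk
    simp only [Function.update_apply] at hj hk
    split_ifs at hj hk with hji hki hki
    · rw [hji, hki]
    · exact absurd (hk.trans hj.symm) (hfree k)
    · exact absurd (hj.trans hk.symm) (hfree j)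
    · exact hA.inj j k g hj hk
  · intro j g hj
    simp only [Function.update_apply] at hj
    split_ifs at hj with hji
    · exact Option.some.inj hj ▸ hh
    · exact hA.mem j g hj
  · intro j g hg
    have h1 := hA.top j g hg
    simp only [Function.update_apply]
    split_ifs with hji
    · subst hji
      rw [hi] at h1
      exact h1.trans (hv j h)
    · exact h1
  · refine card_lt_card (ssubset_iff_of_subset ?_ |>.2 ⟨i, by simp, by simp [hi]⟩)
    intro j hj
    by_cases hji : j = i
    · simp [hji]
    · simpa [Function.update_apply, hji] using hj

theorem TopAlloc.exists_max_size [Fintype N] {v : N → H → ℝ} (hv : ∀ i h, 0 ≤ v i h)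
    {K : Finset H} {A : N → Option H} (hA : TopAlloc v K A) :
    ∃ A', TopAlloc v K A' ∧ min (Fintype.card N) K.card ≤ size A' := by
  by_contra! hcon
  have hgrow : ∀ k : ℕ, ∃ A', TopAlloc v K A' ∧ k ≤ size A' := by
    intro k
    induction k with
    | zero => exact ⟨A, hA, Nat.zero_le _⟩
    | succ k ih =>
      obtain ⟨B, hB, hk⟩ := ih
      obtain ⟨C, hC, hlt⟩ := hB.exists_larger hv (lt_min_iff.1 (hcon B hB)).1
        (lt_min_iff.1 (hcon B hB)).2
      exact ⟨C, hC, by omega⟩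
  obtain ⟨B, _, hB⟩ := hgrow (Fintype.card N + 1)
  have := size_le_card_agents B
  omega

theorem favorites_nonempty {v : N → H → ℝ} {K : Finset H} {i : N} (hi : ∃ h ∈ K, 0 < v i h) :
    (favorites v K i).Nonempty := by
  obtain ⟨h, hh, hpos⟩ := hi
  obtain ⟨g, hg, hmax⟩ := exists_max_image K (v i) ⟨h, hh⟩
  exact ⟨g, mem_filter.2 ⟨hg, hpos.trans_le (hmax h hh), hmax⟩⟩

/-- An agent one of whose favorite houses is used by an envy-free `B` receives a favorite. -/
theorem EF.exists_favorite {v : N → H → ℝ} {B : N → Option H} (hB : EF v B) {K : Finset H}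
    (hK : ∀ i h, B i = some h → h ∈ K) {i j : N} {h : H} (hh : h ∈ favorites v K i)
    (hj : B j = some h) : ∃ g ∈ favorites v K i, B i = some g := by
  obtain ⟨_, hpos, hmax⟩ := mem_filter.1 hh
  have hle := not_lt.1 (hB i j)
  rw [hj] at hle
  cases hg : B i with
  | none =>
    rw [hg] at hle
    exact absurd hpos (not_lt.2 hle)
  | some g =>
    rw [hg] at hle
    exact ⟨g, mem_filter.2 ⟨hK i g hg, hpos.trans_le hle, fun h' hh' => (hmax h' hh').trans hle⟩,
      rfl⟩

/-- No envy-free allocation uses a favorite house of an agent of a minimal Hall violator. -/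
theorem EF.notMem_of_minimal_violator {v : N → H → ℝ} {B : N → Option H} (hinj : Inj B)
    (hB : EF v B) {K : Finset H} (hK : ∀ i h, B i = some h → h ∈ K) {S : Finset N}
    (hS : (S.biUnion (favorites v K)).card < S.card)
    (hmin : ∀ T ⊂ S, T.card ≤ (T.biUnion (favorites v K)).card) {j : N} {h : H}
    (hj : B j = some h) : h ∉ S.biUnion (favorites v K) := by
  intro hh
  set X : Finset H := (S.biUnion (favorites v K)).filter fun g => ∃ k, B k = some g
  set T : Finset N := S.filter fun i => ∃ g ∈ favorites v K i, B i = some g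
  have hTX : T.card ≤ X.card := by
    have h1 : T.card ≤ (X.image some).card := by
      refine card_le_card_of_injOn B ?_ ?_
      · intro i hi
        obtain ⟨hi, g, hg, hgi⟩ := mem_filter.1 (mem_coe.1 hi)
        rw [hgi]
        exact mem_coe.2 (mem_image_of_mem _
          (mem_filter.2 ⟨mem_biUnion.2 ⟨i, hi, hg⟩, i, hgi⟩))
      · intro i hi k _ hik
        obtain ⟨_, g, _, hgi⟩ := mem_filter.1 (mem_coe.1 hi)
        exact hinj i k g hgi (hik ▸ hgi)
    exact h1.trans card_image_le
  obtain ⟨i, hi, hhi⟩ := mem_biUnion.1 hh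
  have hiT : i ∈ T := mem_filter.2 ⟨hi, hB.exists_favorite hK hhi hj⟩
  have hss : S \ T ⊂ S := sdiff_ssubset (filter_subset _ _) ⟨i, hiT⟩
  have hsub : (S \ T).biUnion (favorites v K) ⊆ S.biUnion (favorites v K) \ X := by
    intro g hg
    obtain ⟨k, hk, hgk⟩ := mem_biUnion.1 hg
    obtain ⟨hkS, hkT⟩ := mem_sdiff.1 hk
    refine mem_sdiff.2 ⟨mem_biUnion.2 ⟨k, hkS, hgk⟩, fun hgX => hkT ?_⟩
    obtain ⟨_, l, hl⟩ := mem_filter.1 hgX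
    exact mem_filter.2 ⟨hkS, hB.exists_favorite hK hgk hl⟩
  have hTS : T ⊆ S := filter_subset _ _
  have hXS : X ⊆ S.biUnion (favorites v K) := filter_subset _ _
  have hle := (hmin _ hss).trans (card_le_card hsub)
  rw [card_sdiff_of_subset hTS, card_sdiff_of_subset hXS] at hle
  have hcardT := card_le_card hTS
  have hcardX := card_le_card hXS
  have hTpos := card_pos.2 ⟨i, hiT⟩
  omega

/-- Under Hall's condition the agents with a positively-valued house in `K` can all receive
favorites. -/
theorem exists_topAlloc_of_hall {v : N → H → ℝ} {K : Finset H}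
    (hall : ∀ S : Finset N, (∀ i ∈ S, ∃ h ∈ K, 0 < v i h) →
      S.card ≤ (S.biUnion (favorites v K)).card) : ∃ A, TopAlloc v K A := by
  obtain ⟨f, hf, hfav⟩ := (all_card_le_biUnion_card_iff_exists_injective
    fun i : {i : N // ∃ h ∈ K, 0 < v i h} => favorites v K i).1 (by
      intro s
      have hs := hall (s.map (Function.Embedding.subtype _)) (by
        intro i hi
        obtain ⟨k, _, rfl⟩ := mem_map.1 hi
        exact k.2)
      rwa [card_map, map_eq_image, image_biUnion] at hs)
  refine ⟨fun i => if hi : ∃ h ∈ K, 0 < v i h then some (f ⟨i, hi⟩) else none, ?_, ?_, ?_⟩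
  · intro i j h hi hj
    dsimp only at hi hj
    split_ifs at hi hj with h1 h2
    exact congrArg Subtype.val (hf (Option.some.inj (hi.trans hj.symm)))
  · intro i h hi
    split_ifs at hi with h1
    exact Option.some.inj hi ▸ (mem_filter.1 (hfav ⟨i, h1⟩)).1
  · intro i h hh
    split_ifs with h1
    · exact (mem_filter.1 (hfav ⟨i, h1⟩)).2.2 h hh
    · exact not_lt.1 fun hpos => h1 ⟨h, hh, hpos⟩

theorem exists_containsEF_topAlloc (v : N → H → ℝ) (K : Finset H) (hK : ContainsEF v K) :
    ∃ K', ContainsEF v K' ∧ ∃ A, TopAlloc v K' A := by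
  induction K using Finset.strongInduction with
  | H K ih =>
    by_cases hall : ∀ S : Finset N, (∀ i ∈ S, ∃ h ∈ K, 0 < v i h) →
        S.card ≤ (S.biUnion (favorites v K)).card
    · exact ⟨K, hK, exists_topAlloc_of_hall hall⟩
    · push Not at hall
      obtain ⟨S₀, hS₀⟩ := hall
      obtain ⟨S, ⟨hpos, hS⟩, hmin⟩ := exists_minimal_of_wellFoundedLT
        (fun S : Finset N => (∀ i ∈ S, ∃ h ∈ K, 0 < v i h) ∧
          (S.biUnion (favorites v K)).card < S.card) ⟨S₀, hS₀⟩
      refine ih (K \ S.biUnion (favorites v K)) ?_ ?_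
      · obtain ⟨i, hi⟩ := card_pos.1 (Nat.zero_lt_of_lt hS)
        obtain ⟨h, hh⟩ := favorites_nonempty (hpos i hi)
        refine sdiff_ssubset ?_ ⟨h, mem_biUnion.2 ⟨i, hi, hh⟩⟩
        exact biUnion_subset.2 fun i _ => filter_subset _ _
      · intro B hinj hB j h hj
        refine mem_sdiff.2 ⟨hK B hinj hB j h hj,
          hB.notMem_of_minimal_violator hinj (hK B hinj hB) hS (fun T hT => ?_) hj⟩
        by_contra! hlt
        exact hT.2 (hmin ⟨fun i hi => hpos i (hT.1 hi), hlt⟩ hT.1)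

/-- There is an envy-free allocation simultaneously of maximum size
and maximum utilitarian welfare among all envy-free allocations. -/
theorem stmt1 [Fintype N] [Fintype H]
    (v : N → H → ℝ) (hv : ∀ i h, 0 ≤ v i h) :
    ∃ A : N → Option H, Inj A ∧ EF v A ∧
      ∀ B : N → Option H, Inj B → EF v B → size B ≤ size A ∧ USW v B ≤ USW v A := by
  obtain ⟨K, hK, A₀, hA₀⟩ := exists_containsEF_topAlloc v univ fun _ _ _ _ _ _ => mem_univ _
  obtain ⟨A, hA, hsize⟩ := hA₀.exists_max_size hv
  refine ⟨A, hA.inj, hA.ef hv, fun B hinj hB => ⟨?_, ?_⟩⟩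
  · exact (le_min (size_le_card_agents B) (size_le_card hinj (hK B hinj hB))).trans hsize
  · exact sum_le_sum fun i _ => hA.elim_le hv i (hK B hinj hB i)

end HouseAlloc
end

section
/- Let A be an envy-free allocation in a house allocation instance ⟨N, H, V⟩, let h ∈ H be a house not assigned to any agent under A, let j ∈ N be an agent unassigned under A, and suppose v_i(h) ≤ v_i(A(i)) for every agent i ∈ N (with v_i(A(i)) = 0 for unassigned i). Then the allocation obtained from A by additionally assigning house h to agent j is envy-free. -/
open Finset
open scoped Classical

namespace HouseAlloc

variable {N H : Type*}

/-- Adding an unassigned house, valued by every agent at most its own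
current value, to an unassigned agent preserves envy-freeness. -/
theorem stmt2 [Fintype N] [Fintype H]
    (v : N → H → ℝ) (hv : ∀ i h, 0 ≤ v i h)
    (A : N → Option H) (hA : Inj A) (hEF : EF v A)
    (h : H) (hh : ∀ i, A i ≠ some h)
    (j : N) (hj : A j = none)
    (hle : ∀ i, v i h ≤ (A i).elim 0 (v i)) :
    EF v (fun i => if i = j then some h else A i) := by
  intro i k
  have hik := not_lt.mp (hEF i k)
  have hi := hle i
  unfold Envies
  rw [not_lt]
  by_cases hij : i = j
  · subst hij
    rw [hj] at hik
    by_cases hki : k = i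
    · simp [hki]
    · simpa [hki] using hik.trans (hv i h)
  · by_cases hkj : k = j
    · simpa [hij, hkj] using hi
    · simpa [hij, hkj] using hik

end HouseAlloc
end

section
/- Let ⟨N, H, V⟩ be a house allocation instance and let A be an allocation that maximizes utilitarian welfare USW over all allocations. Then an agent i ∈ N envies some agent under A if and only if v_i(A(i)) < max_{h∈H} v_i(h), where v_i(A(i)) = 0 if i is unassigned. -/
open Finset
open scoped Classical

namespace HouseAlloc

variable {N H : Type*}

/-- Giving an unassigned house to a single agent preserves injectivity. -/
theorem Inj.update {A : N → Option H} (hA : Inj A) (i : N) {h : H} (hh : ∀ j, A j ≠ some h) :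
    Inj (Function.update A i (some h)) := by
  intro a b k ha hb
  simp only [Function.update_apply] at ha hb
  split_ifs at ha hb with h1 h2 h2
  · exact h1.trans h2.symm
  · exact absurd (hb.trans ha.symm) (hh b)
  · exact absurd (ha.trans hb.symm) (hh a)
  · exact hA a b k ha hb

/-- Moving a single agent to a house it strictly prefers strictly increases the welfare. -/
theorem USW_lt_USW_update [Fintype N] (v : N → H → ℝ) (A : N → Option H) (i : N) {h : H}
    (hi : (A i).elim 0 (v i) < v i h) :
    USW v A < USW v (Function.update A i (some h)) := by
  refine Finset.sum_lt_sum (fun j _ => ?_) ⟨i, mem_univ i, by simpa using hi⟩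
  rcases eq_or_ne j i with rfl | hj
  · simpa using hi.le
  · simp [Function.update_of_ne hj]

/-- In a USW-maximizing allocation, an agent envies someone iff it does
not receive a most preferred house. -/
theorem stmt5 [Fintype N] [Fintype H]
    (v : N → H → ℝ) (hv : ∀ i h, 0 ≤ v i h)
    (A : N → Option H) (hA : Inj A)
    (hmax : ∀ B : N → Option H, Inj B → USW v B ≤ USW v A)
    (i : N) :
    (∃ j, Envies v A i j) ↔ (A i).elim 0 (v i) < ⨆ h : H, v i h := by
  constructor
  · rintro ⟨j, hj⟩
    unfold Envies at hj
    cases hAj : A j with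
    | none =>
      have h0 : 0 ≤ (A i).elim 0 (v i) := by
        cases A i with
        | none => exact le_rfl
        | some h => exact hv i h
      rw [hAj] at hj
      exact absurd hj h0.not_gt
    | some h =>
      rw [hAj] at hj
      exact hj.trans_le (le_ciSup (Set.finite_range (v i)).bddAbove h)
  · intro hlt
    rcases isEmpty_or_nonempty H with hH | hH
    · cases hAi : A i with
      | none => simp [hAi, Real.iSup_of_isEmpty] at hlt
      | some h => exact hH.elim h
    · obtain ⟨h, hh⟩ := exists_lt_of_lt_ciSup hlt
      by_contra hno
      refine (USW_lt_USW_update v A i hh).not_ge (hmax _ (hA.update i fun j hj => hno ⟨j, ?_⟩))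
      simpa [Envies, hj] using hh

end HouseAlloc
end

section
/- Let ⟨N, H, V⟩ be a house allocation instance and let A be an allocation that maximizes utilitarian welfare USW over all allocations. Then for every agent i ∈ N, the total envy of agent i satisfies envy_i(A) = Σ_{h∈H} max{v_i(h) − v_i(A(i)), 0}, where v_i(A(i)) = 0 if i is unassigned. -/
open Finset
open scoped Classical

namespace HouseAlloc

variable {N H : Type*}

/-- A house left unassigned by a welfare-maximizing allocation is worth no more to an agent
than what the agent receives. -/
lemma le_elim_of_unassigned [Fintype N] {v : N → H → ℝ} {A : N → Option H} (hA : Inj A)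
    (hmax : ∀ B : N → Option H, Inj B → USW v B ≤ USW v A) (i : N) {h : H}
    (hh : ∀ j, A j ≠ some h) : v i h ≤ (A i).elim 0 (v i) := by
  have hB : Inj (Function.update A i (some h)) := by
    intro j k g hj hk
    by_cases hji : j = i <;> by_cases hki : k = i <;>
      simp only [Function.update_apply, hji, hki, if_true, if_false] at hj hk
    · rw [hji, hki]
    · exact absurd (hk.trans hj.symm) (hh k)
    · exact absurd (hj.trans hk.symm) (hh j)
    · exact hA j k g hj hk
  have hle := hmax _ hB
  unfold USW at hle
  rw [← Finset.add_sum_erase _ _ (Finset.mem_univ i),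
    ← Finset.add_sum_erase (a := i) _ (fun j => (A j).elim 0 (v j)) (Finset.mem_univ i)] at hle
  have hrest : ∑ j ∈ univ.erase i, (Function.update A i (some h) j).elim 0 (v j) =
      ∑ j ∈ univ.erase i, (A j).elim 0 (v j) :=
    Finset.sum_congr rfl fun j hj => by
      rw [Function.update_of_ne (Finset.ne_of_mem_erase hj)]
  rw [hrest] at hle
  rw [Function.update_self] at hle
  exact le_of_add_le_add_right hle

/-- Pairwise envy as a sum over houses, of which only the envied agent's house contributes. -/
lemma pairEnvy_eq_sum [Fintype H] {v : N → H → ℝ} (hv : ∀ i h, 0 ≤ v i h)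
    (A : N → Option H) (i j : N) :
    pairEnvy v A i j =
      ∑ h : H, if A j = some h then max (v i h - (A i).elim 0 (v i)) 0 else 0 := by
  unfold pairEnvy
  cases hj : A j with
  | none =>
    have hi : 0 ≤ (A i).elim 0 (v i) := by
      cases A i with
      | none => exact le_rfl
      | some g => exact hv i g
    simpa using hi
  | some g => simp

/-- In a USW-maximizing allocation, each agent's total envy equals
`Σ_{h∈H} max{v_i(h) − v_i(A(i)), 0}`. -/
theorem stmt6 [Fintype N] [Fintype H]
    (v : N → H → ℝ) (hv : ∀ i h, 0 ≤ v i h)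
    (A : N → Option H) (hA : Inj A)
    (hmax : ∀ B : N → Option H, Inj B → USW v B ≤ USW v A)
    (i : N) :
    agentEnvy v A i = ∑ h : H, max (v i h - (A i).elim 0 (v i)) 0 := by
  unfold agentEnvy
  simp_rw [pairEnvy_eq_sum hv]
  rw [Finset.sum_comm]
  refine Finset.sum_congr rfl fun h _ => ?_
  by_cases hh : ∃ j, A j = some h
  · obtain ⟨j, hj⟩ := hh
    rw [Finset.sum_eq_single j (fun k _ hk => if_neg fun hk' => hk (hA k j h hk' hj))
      (fun hj' => absurd (Finset.mem_univ j) hj'), if_pos hj]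
  · push Not at hh
    have hle := le_elim_of_unassigned hA hmax i hh
    simp [hh, hle]

end HouseAlloc
end

section
/- Let ⟨N, H, V⟩ be a house allocation instance with m ≤ n and let A be an allocation that maximizes utilitarian welfare USW over all allocations. Then there exists a complete allocation Â extending A (every agent assigned under A keeps the same house, and every house is assigned under Â) such that USW(Â) = USW(A) and envy_{i,j}(Â) = envy_{i,j}(A) for all agents i, j ∈ N; in particular Â has the same number of envious agents and the same total envy as A. -/
open Finset
open scoped Classical

namespace HouseAlloc

variable {N H : Type*}

/-- If `A` maximizes utilitarian welfare, no agent strictly prefers an unassigned house to its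
own bundle. -/
theorem le_val_of_unassigned [Fintype N] {v : N → H → ℝ} {A : N → Option H} (hA : Inj A)
    (hmax : ∀ B : N → Option H, Inj B → USW v B ≤ USW v A)
    {h : H} (hh : ∀ k, A k ≠ some h) (i : N) : v i h ≤ (A i).elim 0 (v i) := by
  have hB : Inj (Function.update A i (some h)) := by
    intro a b c ha hb
    by_cases hai : a = i <;> by_cases hbi : b = i <;>
      simp only [Function.update_apply, hai, hbi, if_true, if_false] at ha hb ⊢
    · exact absurd (hb.trans ha.symm) (hh b)
    · exact absurd (ha.trans hb.symm) (hh a)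
    · exact hA a b c ha hb
  have hle := hmax _ hB
  unfold USW at hle
  rw [← add_sum_erase univ _ (mem_univ i),
    ← add_sum_erase univ (fun k => (A k).elim 0 (v k)) (mem_univ i)] at hle
  have hrest : ∑ k ∈ univ.erase i, (Function.update A i (some h) k).elim 0 (v k) =
      ∑ k ∈ univ.erase i, (A k).elim 0 (v k) :=
    sum_congr rfl fun k hk => by rw [Function.update_of_ne (ne_of_mem_erase hk)]
  rw [hrest, Function.update_self] at hle
  exact le_of_add_le_add_right hle

/-- With at most as many houses as agents, the inverse of an allocation extends to an injective
map from houses to agents. -/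
theorem exists_injective_extending [Fintype N] [Fintype H]
    (hmn : Fintype.card H ≤ Fintype.card N) {A : N → Option H} (hA : Inj A) :
    ∃ g : H → N, Function.Injective g ∧ ∀ i h, A i = some h → g h = i := by
  have hassigned : Fintype.card {i // ∃ h, A i = some h} ≤
      Fintype.card {h // ∃ i, A i = some h} := by
    refine Fintype.card_le_of_injective
      (fun i => ⟨i.2.choose, i.1, i.2.choose_spec⟩) fun i j hij => Subtype.ext ?_
    have hc : i.2.choose = j.2.choose := congrArg Subtype.val hij
    exact hA _ _ _ i.2.choose_spec (hc ▸ j.2.choose_spec)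
  have hfree : Fintype.card {h // ¬ ∃ i, A i = some h} ≤
      Fintype.card {i // ¬ ∃ h, A i = some h} := by
    rw [Fintype.card_subtype_compl, Fintype.card_subtype_compl]
    exact tsub_le_tsub hmn hassigned
  obtain ⟨e⟩ := Function.Embedding.nonempty_of_card_le hfree
  refine ⟨fun h => if hh : ∃ i, A i = some h then hh.choose else (e ⟨h, hh⟩).1, ?_, ?_⟩
  · intro h h' heq
    by_cases hh : ∃ i, A i = some h <;> by_cases hh' : ∃ i, A i = some h' <;>
      simp only [hh, hh', dif_pos, dif_neg, not_false_eq_true] at heq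
    · have h1 := hh.choose_spec
      rw [heq, hh'.choose_spec] at h1
      exact (Option.some.inj h1).symm
    · exact absurd ⟨h, heq ▸ hh.choose_spec⟩ (e ⟨h', hh'⟩).2
    · exact absurd ⟨h', heq ▸ hh'.choose_spec⟩ (e ⟨h, hh⟩).2
    · exact congrArg Subtype.val (e.injective (Subtype.ext heq))
  · intro i h hi
    have hh : ∃ i, A i = some h := ⟨i, hi⟩
    simp only [hh, dif_pos]
    exact hA _ _ _ hh.choose_spec hi

theorem envies_iff_pairEnvy_pos {v : N → H → ℝ} {A : N → Option H} {i j : N} :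
    Envies v A i j ↔ 0 < pairEnvy v A i j := by
  simp [Envies, pairEnvy]

/-- With `m ≤ n`, a USW-maximizing allocation extends to a complete
allocation with the same USW and the same pairwise envies (hence the same number of
envious agents and total envy). -/
theorem stmt7 [Fintype N] [Fintype H]
    (v : N → H → ℝ) (hv : ∀ i h, 0 ≤ v i h)
    (hmn : Fintype.card H ≤ Fintype.card N)
    (A : N → Option H) (hA : Inj A)
    (hmax : ∀ B : N → Option H, Inj B → USW v B ≤ USW v A) :
    ∃ Ahat : N → Option H, Inj Ahat ∧
      (∀ i h, A i = some h → Ahat i = some h) ∧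
      Complete Ahat ∧
      USW v Ahat = USW v A ∧
      (∀ i j, pairEnvy v Ahat i j = pairEnvy v A i j) ∧
      numEnvious v Ahat = numEnvious v A ∧
      totalEnvy v Ahat = totalEnvy v A := by
  obtain ⟨g, hg, hgA⟩ := exists_injective_extending hmn hA
  have hinv : ∀ h i, Function.partialInv g i = some h ↔ g h = i := fun h i =>
    hg.isPartialInv h i
  have hext : ∀ i h, A i = some h → Function.partialInv g i = some h := fun i h hi =>
    (hinv h i).2 (hgA i h hi)
  have hcases : ∀ i, Function.partialInv g i = A i ∨
      A i = none ∧ ∃ h, Function.partialInv g i = some h ∧ ∀ k, A k ≠ some h := by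
    intro i
    rcases hAi : A i with _ | h
    · rcases hgi : Function.partialInv g i with _ | h
      · exact Or.inl rfl
      · refine Or.inr ⟨rfl, h, rfl, fun k hk => ?_⟩
        have hki : k = i := (hgA k h hk).symm.trans ((hinv h i).1 hgi)
        rw [hki, hAi] at hk
        cases hk
    · exact Or.inl (hext i h hAi)
  have hval : ∀ i, (Function.partialInv g i).elim 0 (v i) = (A i).elim 0 (v i) := by
    intro i
    rcases hcases i with hi | ⟨hi, h, hgi, hh⟩
    · rw [hi]
    · have hle := le_val_of_unassigned hA hmax hh i
      rw [hi] at hle ⊢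
      rw [hgi]
      exact le_antisymm hle (hv i h)
  have hpair : ∀ i j, pairEnvy v (Function.partialInv g) i j = pairEnvy v A i j := by
    intro i j
    unfold pairEnvy
    rw [hval i]
    rcases hcases j with hj | ⟨hj, h, hgj, hh⟩
    · rw [hj]
    · have hle := le_val_of_unassigned hA hmax hh i
      have hnonneg := (hv i h).trans hle
      rw [hj, hgj, Option.elim_some, Option.elim_none, max_eq_right (sub_nonpos.2 hle), max_eq_right (sub_nonpos.2 hnonneg)]
  refine ⟨Function.partialInv g, ?_, hext, fun h => ⟨g h, (hinv h _).2 rfl⟩,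
    sum_congr rfl fun i _ => hval i, hpair, ?_, ?_⟩
  · exact fun i j h hi hj => ((hinv h i).1 hi).symm.trans ((hinv h j).1 hj)
  · simp only [numEnvious, envies_iff_pairEnvy_pos, hpair]
  · simp only [totalEnvy, agentEnvy, hpair]

end HouseAlloc
end

section
/- Let ⟨N, H, V⟩ be a binary house allocation instance (every v_i(h) ∈ {0,1}) with m ≤ n. Then every complete allocation A satisfies #envy(A) + USW(A) = |{ i ∈ N : v_i(h) = 1 for some h ∈ H }|. -/
open Finset
open scoped Classical

namespace HouseAlloc

variable {N H : Type*}

/-- Under a complete allocation, an agent of a binary instance is envious exactly when it values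
some house but does not receive a house it values. -/
theorem envious_indicator_add_value (v : N → H → ℝ) (hbin : ∀ i h, v i h = 0 ∨ v i h = 1)
    (A : N → Option H) (hc : Complete A) (i : N) :
    (if ∃ j, Envies v A i j then (1 : ℝ) else 0) + (A i).elim 0 (v i)
      = if ∃ h, v i h = 1 then 1 else 0 := by
  have hval : ∀ j, (A j).elim 0 (v i) = 0 ∨ ∃ h, v i h = 1 ∧ (A j).elim 0 (v i) = 1 := by
    intro j
    cases A j with
    | none => exact Or.inl rfl
    | some h => exact (hbin i h).imp id fun h1 => ⟨h, h1, h1⟩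
  rcases hval i with h0 | ⟨h, h1, hA1⟩
  · have henvy : (∃ j, Envies v A i j) ↔ ∃ h, v i h = 1 := by
      constructor
      · rintro ⟨j, hj⟩
        rcases hval j with hj0 | ⟨h, h1, -⟩
        · rw [Envies, h0, hj0] at hj
          exact absurd hj (lt_irrefl _)
        · exact ⟨h, h1⟩
      · rintro ⟨h, h1⟩
        obtain ⟨j, hj⟩ := hc h
        refine ⟨j, ?_⟩
        rw [Envies, h0, hj, Option.elim_some, h1]
        exact one_pos
    simp only [henvy, h0, add_zero]
  · have henvy : ¬ ∃ j, Envies v A i j := by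
      rintro ⟨j, hj⟩
      rw [Envies, hA1] at hj
      rcases hval j with hj0 | ⟨-, -, hj1⟩ <;> linarith
    rw [if_neg henvy, if_pos ⟨h, h1⟩, hA1, zero_add]

/-- In a binary instance with `m ≤ n`, every complete allocation `A`
satisfies `#envy(A) + USW(A) = |{i : v_i(h) = 1 for some h}|`. -/
theorem stmt8 [Fintype N] [Fintype H]
    (v : N → H → ℝ) (hbin : ∀ i h, v i h = 0 ∨ v i h = 1)
    (hmn : Fintype.card H ≤ Fintype.card N)
    (A : N → Option H) (hA : Inj A) (hc : Complete A) :
    (numEnvious v A : ℝ) + USW v A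
      = ((univ.filter fun i : N => ∃ h, v i h = 1).card : ℝ) := by
  rw [numEnvious, USW, Finset.natCast_card_filter, Finset.natCast_card_filter,
    ← Finset.sum_add_distrib]
  refine Finset.sum_congr rfl fun i _ => ?_
  convert envious_indicator_add_value v hbin A hc i

end HouseAlloc
end

section
/- Let ⟨N, H, V⟩ be a binary house allocation instance (every v_i(h) ∈ {0,1}) with m ≤ n. Then (i) the maximum of USW over complete allocations equals the maximum of USW over all allocations, and (ii) a complete allocation A minimizes #envy among all complete allocations if and only if A maximizes USW among all complete allocations. -/
open Finset
open scoped Classical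

namespace HouseAlloc

variable {N H : Type*}

/-- When there are at least as many agents as houses, every allocation extends to a complete one. -/
theorem Inj.exists_complete_extension [Fintype N] [Fintype H]
    (hmn : Fintype.card H ≤ Fintype.card N) {B : N → Option H} (hB : Inj B) :
    ∃ A : N → Option H, Inj A ∧ Complete A ∧ ∀ i h, B i = some h → A i = some h := by
  by_cases hN : Nonempty N
  · set S : Finset H := univ.filter fun h => ∃ i, B i = some h
    have hch : ∀ h, ∃ i, h ∈ S → B i = some h := fun h => by
      by_cases hh : h ∈ S
      · obtain ⟨i, hi⟩ := (mem_filter.1 hh).2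
        exact ⟨i, fun _ => hi⟩
      · exact ⟨Classical.arbitrary N, fun h' => absurd h' hh⟩
    choose f hf using hch
    have hfS : Set.InjOn f S := fun a ha b hb hab => by
      have h1 := hf a ha
      rw [hab, hf b hb] at h1
      exact (Option.some.inj h1).symm
    obtain ⟨t, hSt, ht⟩ := exists_superset_card_eq
      (card_image_le.trans (card_le_univ S) : (S.image f).card ≤ Fintype.card H) hmn
    obtain ⟨g, hg⟩ := exists_equiv_extend_of_card_eq ht.symm hSt hfS
    have hinj : Function.Injective fun h => (g h : N) :=
      Subtype.val_injective.comp g.injective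
    have hinv := hinj.isPartialInv
    refine ⟨Function.partialInv fun h => (g h : N), fun i j h hi hj => ?_,
      fun h => ⟨g h, (hinv h _).2 rfl⟩, fun i h hi => (hinv h i).2 ?_⟩
    · exact ((hinv h i).1 hi).symm.trans ((hinv h j).1 hj)
    · have hh : h ∈ S := mem_filter.2 ⟨mem_univ _, i, hi⟩
      exact (hg h hh).trans (hB _ _ h (hf h hh) hi)
  · have hN' : IsEmpty N := not_nonempty_iff.1 hN
    have hH : IsEmpty H := Fintype.card_eq_zero_iff.1 (by simpa using hmn)
    exact ⟨B, hB, fun h => hH.elim h, fun _ _ h => h⟩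

/-- In a binary instance, a complete allocation satisfies or makes envious exactly the agents
that like some house. -/
theorem Complete.usw_add_numEnvious [Fintype N] {v : N → H → ℝ}
    (hbin : ∀ i h, v i h = 0 ∨ v i h = 1) {A : N → Option H} (hA : Complete A) :
    USW v A + numEnvious v A = ((univ.filter fun i => ∃ h, v i h = 1).card : ℝ) := by
  rw [USW, numEnvious, card_filter, card_filter]
  push_cast
  rw [← sum_add_distrib]
  refine sum_congr rfl fun i _ => ?_
  have hval : ∀ o : Option H, o.elim 0 (v i) = 0 ∨ ∃ h, v i h = 1 ∧ o.elim 0 (v i) = 1 := by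
    rintro (_ | h)
    · exact Or.inl rfl
    · exact (hbin i h).imp id fun h1 => ⟨h, h1, h1⟩
  have hle : ∀ o : Option H, o.elim 0 (v i) ≤ 1 := fun o => by
    rcases hval o with h | ⟨_, _, h⟩ <;> rw [h]
    exact zero_le_one
  rcases hval (A i) with h0 | ⟨h, h1, hi⟩
  · have hiff : (∃ j, Envies v A i j) ↔ ∃ h, v i h = 1 := by
      constructor
      · rintro ⟨j, hj⟩
        rw [Envies, h0] at hj
        rcases hval (A j) with h | ⟨h, h1, -⟩
        · exact absurd h hj.ne'
        · exact ⟨h, h1⟩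
      · rintro ⟨h, h1⟩
        obtain ⟨j, hj⟩ := hA h
        refine ⟨j, ?_⟩
        rw [Envies, h0, hj, Option.elim_some, h1]
        exact one_pos
    simp only [h0, hiff, zero_add]
  · have hno : ¬ ∃ j, Envies v A i j := by
      rintro ⟨j, hj⟩
      rw [Envies, hi] at hj
      exact (hle (A j)).not_gt hj
    rw [hi, if_neg hno, if_pos ⟨h, h1⟩, add_zero]

/-- In a binary instance with `m ≤ n`: (i) some complete allocation
attains the maximum USW over all allocations, and (ii) a complete allocation
minimizes `#envy` among complete allocations iff it maximizes USW among them. -/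
theorem stmt9 [Fintype N] [Fintype H]
    (v : N → H → ℝ) (hbin : ∀ i h, v i h = 0 ∨ v i h = 1)
    (hmn : Fintype.card H ≤ Fintype.card N) :
    (∃ A : N → Option H, Inj A ∧ Complete A ∧
        ∀ B : N → Option H, Inj B → USW v B ≤ USW v A) ∧
    (∀ A : N → Option H, Inj A → Complete A →
      ((∀ B : N → Option H, Inj B → Complete B → numEnvious v A ≤ numEnvious v B) ↔
       (∀ B : N → Option H, Inj B → Complete B → USW v B ≤ USW v A))) := by
  constructor
  · obtain ⟨M, hM, hmax⟩ := Set.exists_max_image {B : N → Option H | Inj B} (USW v)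
      (Set.toFinite _) ⟨fun _ => none, fun _ _ _ h => nomatch h⟩
    obtain ⟨A, hA, hAc, hext⟩ := Inj.exists_complete_extension hmn hM
    refine ⟨A, hA, hAc, fun B hB => (hmax B hB).trans (sum_le_sum fun i _ => ?_)⟩
    rcases hMi : M i with _ | h
    · rcases A i with _ | h
      · exact le_rfl
      · rcases hbin i h with h0 | h1
        · exact h0.ge
        · exact zero_le_one.trans h1.ge
    · rw [hext i h hMi]
  · intro A _ hAc
    refine forall_congr' fun B => forall_congr' fun _ => forall_congr' fun hBc => ?_
    have hsum := (hAc.usw_add_numEnvious hbin).trans (hBc.usw_add_numEnvious hbin).symm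
    rw [← Nat.cast_le (α := ℝ)]
    constructor <;> intro h <;> linarith

end HouseAlloc
end

section
/- Let ⟨N, H, V⟩ be a house allocation instance with m ≤ n. Let G⁺_max be the bipartite graph on N ∪ H with an edge (i, h) exactly when v_i(h) = max_{h'∈H} v_i(h') and v_i(h) > 0, and let ν be the maximum size of a matching in G⁺_max. Then the minimum, over all complete allocations A, of the number of envious agents #envy(A) equals |{ i ∈ N : max_{h∈H} v_i(h) > 0 }| − ν. -/
open Finset
open scoped Classical

namespace HouseAlloc

variable {N H : Type*}

/-- A finite injective partial assignment of agents to houses extends to all houses when there are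
at least as many agents as houses. -/
theorem exists_injective_extending_s10 [Fintype N] [Fintype H]
    (hmn : Fintype.card H ≤ Fintype.card N) (M : Finset (N × H))
    (hM : ∀ p ∈ M, ∀ q ∈ M, p ≠ q → p.1 ≠ q.1 ∧ p.2 ≠ q.2) :
    ∃ g : H → N, Function.Injective g ∧ ∀ p ∈ M, g p.2 = p.1 := by
  have key : ∀ h : H, ∃ i : N, h ∈ M.image Prod.snd → (i, h) ∈ M := by
    intro h
    by_cases hh : h ∈ M.image Prod.snd
    · obtain ⟨p, hp, rfl⟩ := Finset.mem_image.1 hh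
      exact ⟨p.1, fun _ => hp⟩
    · have hN : 0 < Fintype.card N :=
        (Fintype.card_pos_iff.2 ⟨h⟩).trans_le hmn
      obtain ⟨i⟩ := Fintype.card_pos_iff.1 hN
      exact ⟨i, fun h' => absurd h' hh⟩
  choose f hf using key
  have hfM : ∀ p ∈ M, f p.2 = p.1 := by
    intro p hp
    have h1 := hf p.2 (Finset.mem_image_of_mem _ hp)
    by_contra hne
    exact (hM _ h1 _ hp (fun h => hne (congrArg Prod.fst h))).2 rfl
  have hinj : Set.InjOn f (M.image Prod.snd : Finset H) := by
    intro a ha b hb hab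
    by_contra hne
    exact (hM _ (hf a ha) _ (hf b hb) (fun h => hne (congrArg Prod.snd h))).1 hab
  obtain ⟨t, ht, -, htc⟩ := Finset.exists_subsuperset_card_eq
    (Finset.subset_univ ((M.image Prod.snd).image f))
    (Finset.card_image_le.trans (Finset.card_le_univ (M.image Prod.snd)))
    (by rwa [Finset.card_univ])
  obtain ⟨g, hg⟩ := Finset.exists_equiv_extend_of_card_eq htc.symm ht hinj
  refine ⟨fun h => g h, Subtype.val_injective.comp g.injective, fun p hp => ?_⟩
  rw [← hfM p hp]
  exact hg _ (Finset.mem_image_of_mem _ hp)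

/-- Under a complete allocation, an agent is not envious exactly when she values no house or
receives a positively-valued most preferred one. -/
theorem exists_envies_iff [Fintype H] {v : N → H → ℝ} (hv : ∀ i h, 0 ≤ v i h)
    {A : N → Option H} (hA : Complete A) (i : N) :
    (∃ j, Envies v A i j) ↔ (0 < ⨆ h : H, v i h) ∧ ¬ ∃ h, A i = some h ∧ Edge v i h := by
  have hle : ∀ h, v i h ≤ ⨆ h' : H, v i h' :=
    fun h => le_ciSup (Set.finite_range (v i)).bddAbove h
  constructor
  · rintro ⟨j, hj⟩
    unfold Envies at hj
    have h0 : 0 ≤ (A i).elim 0 (v i) := by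
      cases A i with
      | none => exact le_rfl
      | some h => exact hv i h
    cases hAj : A j with
    | none =>
      rw [hAj] at hj
      exact absurd h0 (not_le.2 hj)
    | some h =>
      rw [hAj] at hj
      change _ < v i h at hj
      refine ⟨(h0.trans_lt hj).trans_le (hle h), ?_⟩
      rintro ⟨h', hAi, he, -⟩
      rw [hAi] at hj
      exact absurd (hle h) (not_le.2 (he ▸ hj))
  · rintro ⟨hpos, hno⟩
    have hne : Nonempty H := by
      by_contra hem
      rw [not_nonempty_iff] at hem
      simp at hpos
    obtain ⟨h, hh⟩ := exists_eq_ciSup_of_finite (f := v i)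
    obtain ⟨j, hj⟩ := hA h
    refine ⟨j, ?_⟩
    unfold Envies
    rw [hj]
    change _ < v i h
    cases hAi : A i with
    | none => exact hh ▸ hpos
    | some h' =>
      change v i h' < v i h
      rw [hh]
      refine (hle h').lt_of_ne fun heq => hno ⟨h', hAi, heq, heq ▸ hpos⟩

/-- Under a complete allocation, the envious agents and the agents receiving a positively-valued
most preferred house partition the agents valuing some house. -/
theorem numEnvious_add_card [Fintype N] [Fintype H] {v : N → H → ℝ} (hv : ∀ i h, 0 ≤ v i h)
    {A : N → Option H} (hA : Complete A) :
    numEnvious v A + (univ.filter fun p : N × H => A p.1 = some p.2 ∧ Edge v p.1 p.2).card =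
      (univ.filter fun i : N => 0 < ⨆ h : H, v i h).card := by
  have himg : (univ.filter fun p : N × H => A p.1 = some p.2 ∧ Edge v p.1 p.2).card =
      (univ.filter fun i : N =>
        (0 < ⨆ h : H, v i h) ∧ ∃ h, A i = some h ∧ Edge v i h).card := by
    refine Finset.card_bij (fun p _ => p.1) ?_ ?_ ?_
    · intro p hp
      obtain ⟨h1, h2⟩ := (Finset.mem_filter.1 hp).2
      exact Finset.mem_filter.2 ⟨Finset.mem_univ _, h2.1 ▸ h2.2, p.2, h1, h2⟩
    · intro p hp q hq hpq
      have h1 := (Finset.mem_filter.1 hp).2.1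
      have h2 := (Finset.mem_filter.1 hq).2.1
      rw [hpq, h2] at h1
      exact Prod.ext hpq (Option.some.inj h1).symm
    · intro i hi
      obtain ⟨-, h, hh⟩ := (Finset.mem_filter.1 hi).2
      exact ⟨(i, h), Finset.mem_filter.2 ⟨Finset.mem_univ _, hh⟩, rfl⟩
  rw [himg, numEnvious, Finset.filter_congr fun i _ => exists_envies_iff hv hA i,
    ← Finset.filter_filter, ← Finset.filter_filter, add_comm]
  exact Finset.card_filter_add_card_filter_not _

/-- With `m ≤ n`, the minimum number of envious agents over complete
allocations equals `|{i : max_h v_i(h) > 0}| − ν`, where `ν` is the maximum size of a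
matching in the graph of positively-valued most preferred houses. -/
theorem stmt10 [Fintype N] [Fintype H]
    (v : N → H → ℝ) (hv : ∀ i h, 0 ≤ v i h)
    (hmn : Fintype.card H ≤ Fintype.card N)
    (ν : ℕ)
    (hν : IsGreatest {k : ℕ | ∃ M : Finset (N × H),
        (∀ p ∈ M, Edge v p.1 p.2) ∧
        (∀ p ∈ M, ∀ q ∈ M, p ≠ q → p.1 ≠ q.1 ∧ p.2 ≠ q.2) ∧
        M.card = k} ν) :
    IsLeast {k : ℕ | ∃ A : N → Option H, Inj A ∧ Complete A ∧ numEnvious v A = k}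
      ((univ.filter fun i : N => 0 < ⨆ h : H, v i h).card - ν) := by
  have hbound : ∀ A : N → Option H, Inj A →
      (univ.filter fun p : N × H => A p.1 = some p.2 ∧ Edge v p.1 p.2).card ≤ ν := by
    intro A hinj
    refine hν.2 ⟨_, fun p hp => (Finset.mem_filter.1 hp).2.2, ?_, rfl⟩
    intro p hp q hq hpq
    have h1 := (Finset.mem_filter.1 hp).2.1
    have h2 := (Finset.mem_filter.1 hq).2.1
    refine ⟨fun h => hpq ?_, fun h => hpq ?_⟩
    · rw [h, h2] at h1
      exact Prod.ext h (Option.some.inj h1).symm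
    · rw [← h] at h2
      exact Prod.ext (hinj _ _ _ h1 h2) h
  constructor
  · obtain ⟨M, hedge, hM, hcard⟩ := hν.1
    obtain ⟨g, hg, hgM⟩ := exists_injective_extending_s10 hmn M hM
    have hA : ∀ h i, Function.partialInv g i = some h ↔ g h = i :=
      hg.isPartialInv
    have hinj : Inj (Function.partialInv g) := fun i j h hi hj =>
      ((hA h i).1 hi).symm.trans ((hA h j).1 hj)
    have hcomplete : Complete (Function.partialInv g) := fun h => ⟨g h, (hA h _).2 rfl⟩
    refine ⟨Function.partialInv g, hinj, hcomplete, ?_⟩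
    have hle : M.card ≤ (univ.filter fun p : N × H =>
        Function.partialInv g p.1 = some p.2 ∧ Edge v p.1 p.2).card :=
      Finset.card_le_card fun p hp =>
        Finset.mem_filter.2 ⟨Finset.mem_univ _, (hA _ _).2 (hgM p hp), hedge p hp⟩
    have hge := hbound _ hinj
    have hsum := numEnvious_add_card hv hcomplete
    omega
  · rintro k ⟨A, hinj, hcomplete, rfl⟩
    have hge := hbound A hinj
    have hsum := numEnvious_add_card hv hcomplete
    omega

end HouseAlloc
end

section
/- Let G = (X, E) be a finite simple graph, let k ≤ |X|, and let β > 0. Construct a house allocation instance as follows: the agents are a vertex-agent a_x for each x ∈ X and three edge-agents a_e^1, a_e^2, a_e^3 for each e ∈ E; the houses are a vertex-house h_x for each x ∈ X together with a set D of 3|E| + |X| − k dummy houses; the valuations are v_{a_x}(h_x) = β + 1 and v_{a_x}(h) = β for every other house h, and for each edge e = {x, y} and each i ∈ {1,2,3}, v_{a_e^i}(h) = β + 1 if h ∈ {h_x, h_y} and v_{a_e^i}(h) = β otherwise. Then G has an independent set of size at least k if and only if this instance admits an allocation assigning a house to every agent in which every agent's total envy is at most 1. -/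
open Finset
open scoped Classical

namespace Stmt13

/-- Valuations of the house allocation instance built from a graph `G`:
agents are vertex-agents (`Sum.inl x`) and three edge-agents per edge
(`Sum.inr (e, i)`); houses are vertex-houses (`Sum.inl y`) and `d` dummy houses
(`Sum.inr`).  A vertex-agent `a_x` values `h_x` at `β + 1` and everything else at `β`;
an edge-agent for `e = {x, y}` values `h_x` and `h_y` at `β + 1` and everything else
at `β`. -/
noncomputable def redV {X : Type*} (G : SimpleGraph X) (d : ℕ) (β : ℝ) :
    X ⊕ (G.edgeSet × Fin 3) → X ⊕ Fin d → ℝ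
  | Sum.inl x, Sum.inl y => if y = x then β + 1 else β
  | Sum.inl _, Sum.inr _ => β
  | Sum.inr e, Sum.inl y => if y ∈ (e.1 : Sym2 X) then β + 1 else β
  | Sum.inr _, Sum.inr _ => β

theorem redV_mem_Icc {X : Type*} (G : SimpleGraph X) (d : ℕ) (β : ℝ)
    (i : X ⊕ (G.edgeSet × Fin 3)) (h : X ⊕ Fin d) : redV G d β i h ∈ Set.Icc β (β + 1) := by
  rcases i with x | e <;> rcases h with y | y <;> simp only [redV, Set.mem_Icc] <;>
    (try split_ifs) <;> constructor <;> linarith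

/-- If there are at least as many dummies `D` as agents outside `T`, then the agents of `T` can
receive their own houses while all other agents receive distinct dummies. -/
theorem exists_allocation {X Y D : Type*} [Fintype X] [Fintype Y] [Fintype D] (T : Finset X)
    (h : Fintype.card X + Fintype.card Y ≤ Fintype.card D + T.card) :
    ∃ f : X ⊕ Y → X ⊕ D, Function.Injective f ∧ (∀ x ∈ T, f (Sum.inl x) = Sum.inl x) ∧
      ∀ a y, f a = Sum.inl y → a = Sum.inl y ∧ y ∈ T := by
  let C : Finset (X ⊕ Y) := univ \ T.map ⟨Sum.inl, Sum.inl_injective⟩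
  have hC : Fintype.card C ≤ Fintype.card D := by
    rw [Fintype.card_coe, card_sdiff_of_subset (subset_univ _), card_map, card_univ,
      Fintype.card_sum]
    omega
  obtain ⟨g⟩ := Function.Embedding.nonempty_of_card_le hC
  have hmem : ∀ a, a ∉ C → ∃ x ∈ T, a = Sum.inl x := by
    intro a ha
    simp only [C, mem_sdiff, mem_univ, mem_map, true_and, not_not] at ha
    obtain ⟨x, hx, rfl⟩ := ha
    exact ⟨x, hx, rfl⟩
  have hT : ∀ x ∈ T, (Sum.inl x : X ⊕ Y) ∉ C := by
    intro x hx
    simp [C, hx]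
  let f : X ⊕ Y → X ⊕ D := fun a =>
    if ha : a ∈ C then Sum.inr (g ⟨a, ha⟩) else Sum.inl (hmem a ha).choose
  have hf : ∀ a y, f a = Sum.inl y → a = Sum.inl y ∧ y ∈ T := by
    intro a y hy
    by_cases ha : a ∈ C
    · simp [f, ha] at hy
    · have hs := (hmem a ha).choose_spec
      simp only [f, ha, dif_neg, not_false_eq_true, Sum.inl.injEq] at hy
      rw [hy] at hs
      exact ⟨hs.2, hs.1⟩
  refine ⟨f, ?_, ?_, hf⟩
  · intro a b hab
    rcases hfa : f a with y | z
    · rw [(hf a y hfa).1, (hf b y (hab ▸ hfa)).1]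
    · by_cases ha : a ∈ C
      · by_cases hb : b ∈ C
        · simpa [f, ha, hb] using hab
        · simp [f, ha, hb] at hab
      · simp [f, ha] at hfa
  · intro x hx
    rcases hfa : f (Sum.inl x) with y | z
    · rw [Sum.inl.inj (hf _ y hfa).1]
    · simp [f, hT x hx] at hfa

/-- Giving the members of an independent set `T` their own houses and everybody else a dummy makes
every agent's total envy at most `1`. -/
theorem sum_envy_le_one {X : Type*} [Fintype X] (G : SimpleGraph X) [Fintype G.edgeSet]
    (d : ℕ) (β : ℝ) (T : Finset X) (hT : ∀ x ∈ T, ∀ y ∈ T, ¬ G.Adj x y)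
    (f : X ⊕ (G.edgeSet × Fin 3) → X ⊕ Fin d) (hfT : ∀ x ∈ T, f (Sum.inl x) = Sum.inl x)
    (hf : ∀ a y, f a = Sum.inl y → a = Sum.inl y ∧ y ∈ T) (i : X ⊕ (G.edgeSet × Fin 3)) :
    ∑ j, max (redV G d β i (f j) - redV G d β i (f i)) 0 ≤ 1 := by
  rcases i with x | e
  · refine (sum_nonpos fun j _ => max_le ?_ le_rfl).trans zero_le_one
    by_cases hx : x ∈ T
    · rw [hfT x hx]
      have := (redV_mem_Icc G d β (Sum.inl x) (f j)).2
      simp only [redV, if_true] at this ⊢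
      linarith
    · have h1 := (redV_mem_Icc G d β (Sum.inl x) (f (Sum.inl x))).1
      have h2 : redV G d β (Sum.inl x) (f j) = β := by
        rcases hj : f j with y | z
        · have hy : y ≠ x := fun h => hx (h ▸ (hf j y hj).2)
          simp [redV, hy]
        · rfl
      linarith
  · let P : Finset (X ⊕ (G.edgeSet × Fin 3)) :=
      univ.filter fun j => ∃ y ∈ (e.1 : Sym2 X), f j = Sum.inl y
    have hP : P.card ≤ 1 := by
      refine card_le_one.2 fun a ha b hb => ?_
      obtain ⟨y, hy, hay⟩ := (mem_filter.1 ha).2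
      obtain ⟨z, hz, hbz⟩ := (mem_filter.1 hb).2
      obtain ⟨rfl, hyT⟩ := hf a y hay
      obtain ⟨rfl, hzT⟩ := hf b z hbz
      by_contra hne
      have hyz : y ≠ z := fun h => hne (congrArg _ h)
      have he : (e.1 : Sym2 X) = s(y, z) := (Sym2.mem_and_mem_iff hyz).1 ⟨hy, hz⟩
      exact hT y hyT z hzT (G.mem_edgeSet.1 (he ▸ e.1.2))
    calc _ ≤ ∑ j, if j ∈ P then (1 : ℝ) else 0 := by
          refine sum_le_sum fun j _ => ?_
          have h1 := (redV_mem_Icc G d β (Sum.inr e) (f (Sum.inr e))).1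
          have h2 := (redV_mem_Icc G d β (Sum.inr e) (f j)).2
          split_ifs with hj
          · exact max_le (by linarith) zero_le_one
          · have h3 : redV G d β (Sum.inr e) (f j) = β := by
              rcases hfj : f j with y | z
              · have hy : y ∉ (e.1 : Sym2 X) := fun h =>
                  hj (mem_filter.2 ⟨mem_univ _, y, h, hfj⟩)
                simp [redV, hy]
              · rfl
            exact max_le (by linarith) le_rfl
      _ = P.card := by simp
      _ ≤ 1 := by exact_mod_cast hP

/-- If every agent's total envy is at most `1`, then the vertices whose houses are allocated form
an independent set. -/
theorem not_adj_of_sum_envy_le_one {X : Type*} [Fintype X] (G : SimpleGraph X)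
    [Fintype G.edgeSet] (d : ℕ) (β : ℝ) (f : X ⊕ (G.edgeSet × Fin 3) → X ⊕ Fin d)
    (hinj : Function.Injective f)
    (henvy : ∀ i, ∑ j, max (redV G d β i (f j) - redV G d β i (f i)) 0 ≤ 1)
    {a b : X ⊕ (G.edgeSet × Fin 3)} {x y : X} (ha : f a = Sum.inl x) (hb : f b = Sum.inl y) :
    ¬ G.Adj x y := by
  intro hxy
  have hab : a ≠ b := by
    rintro rfl
    exact hxy.ne (Sum.inl.inj (ha.symm.trans hb))
  let e : G.edgeSet := ⟨s(x, y), hxy⟩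
  obtain ⟨i, hia, hib⟩ : ∃ i : Fin 3, Sum.inr (e, i) ≠ a ∧ Sum.inr (e, i) ≠ b := by
    by_contra! hcon
    have hsub : (univ.image fun i : Fin 3 => (Sum.inr (e, i) : X ⊕ (G.edgeSet × Fin 3))) ⊆
        {a, b} := by
      intro c hc
      obtain ⟨i, -, rfl⟩ := mem_image.1 hc
      rw [mem_insert, mem_singleton]
      exact or_iff_not_imp_left.2 (hcon i)
    have hcard := card_le_card hsub
    rw [card_image_of_injective _ fun i j h => (Prod.mk.inj (Sum.inr.inj h)).2, card_univ,
      Fintype.card_fin] at hcard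
    have := card_le_two (a := a) (b := b)
    omega
  have hown : redV G d β (Sum.inr (e, i)) (f (Sum.inr (e, i))) = β := by
    rcases hfi : f (Sum.inr (e, i)) with z | z
    · have hz : z ∉ (e : Sym2 X) := by
        intro hz
        rcases Sym2.mem_iff.1 hz with rfl | rfl
        · exact hia (hinj (hfi.trans ha.symm))
        · exact hib (hinj (hfi.trans hb.symm))
      simp [redV, hz]
    · rfl
  have hva : redV G d β (Sum.inr (e, i)) (f a) = β + 1 := by
    rw [ha]; simp [redV, e]
  have hvb : redV G d β (Sum.inr (e, i)) (f b) = β + 1 := by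
    rw [hb]; simp [redV, e]
  have hle := sum_le_sum_of_subset_of_nonneg (subset_univ {a, b})
    (f := fun j => max (redV G d β (Sum.inr (e, i)) (f j) -
      redV G d β (Sum.inr (e, i)) (f (Sum.inr (e, i)))) 0) fun j _ _ => le_max_right _ _
  rw [sum_pair hab, hva, hvb, hown] at hle
  have h1 := henvy (Sum.inr (e, i))
  rw [hown] at h1
  have h2 : max (β + 1 - β) 0 = 1 := by
    rw [add_sub_cancel_left, max_eq_left zero_le_one]
  rw [h2] at hle
  linarith

/-- An injective assignment of the agents to vertex-houses and dummies uses at least as many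
vertex-houses as there are agents in excess of the dummies. -/
theorem exists_allocated {X N D : Type*} [Fintype X] [Fintype N] [Fintype D]
    (f : N → X ⊕ D) (hinj : Function.Injective f) :
    ∃ S : Finset X, Fintype.card N ≤ S.card + Fintype.card D ∧ ∀ x ∈ S, ∃ a, f a = Sum.inl x := by
  have hsub : univ.image f ⊆
      (univ.filter fun x => ∃ a, f a = Sum.inl x).disjSum (univ : Finset D) := by
    intro h hh
    obtain ⟨a, -, rfl⟩ := mem_image.1 hh
    rcases hfa : f a with x | z
    · exact inl_mem_disjSum.2 (mem_filter.2 ⟨mem_univ _, a, hfa⟩)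
    · exact inr_mem_disjSum.2 (mem_univ _)
  have := card_le_card hsub
  rw [card_image_of_injective _ hinj, card_disjSum, card_univ, card_univ] at this
  exact ⟨_, this, fun x hx => (mem_filter.1 hx).2⟩

/-- `G` has an independent set of size at least `k` iff the constructed
house allocation instance (with `3|E| + |X| − k` dummy houses) admits an allocation
assigning a house to every agent in which every agent's total envy is at most `1`. -/
theorem stmt13 {X : Type*} [Fintype X] [DecidableEq X]
    (G : SimpleGraph X) [Fintype G.edgeSet]
    (k : ℕ) (hk : k ≤ Fintype.card X) (β : ℝ) (hβ : 0 < β) :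
    (∃ S : Finset X, k ≤ S.card ∧ ∀ x ∈ S, ∀ y ∈ S, ¬ G.Adj x y) ↔
    (∃ A : X ⊕ (G.edgeSet × Fin 3) →
        Option (X ⊕ Fin (3 * G.edgeFinset.card + Fintype.card X - k)),
      (∀ a b h, A a = some h → A b = some h → a = b) ∧
      (∀ a, (A a).isSome = true) ∧
      (∀ i, (∑ j, max
          ((A j).elim 0 (redV G (3 * G.edgeFinset.card + Fintype.card X - k) β i) -
           (A i).elim 0 (redV G (3 * G.edgeFinset.card + Fintype.card X - k) β i)) 0) ≤ 1)) := by
  have hE : Fintype.card (G.edgeSet × Fin 3) = 3 * G.edgeFinset.card := by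
    rw [Fintype.card_prod, Fintype.card_fin, SimpleGraph.edgeFinset_card, mul_comm]
  constructor
  · rintro ⟨S, hkS, hS⟩
    obtain ⟨T, hTS, hTk⟩ := exists_subset_card_eq hkS
    obtain ⟨f, hinj, hfT, hf⟩ := exists_allocation (Y := G.edgeSet × Fin 3)
      (D := Fin (3 * G.edgeFinset.card + Fintype.card X - k)) T
      (by rw [hE, Fintype.card_fin]; omega)
    refine ⟨fun a => some (f a), ?_, fun _ => rfl, ?_⟩
    · intro a b h ha hb
      exact hinj (Option.some.inj (ha.trans hb.symm))
    · exact sum_envy_le_one G _ β T (fun x hx y hy => hS x (hTS hx) y (hTS hy)) f hfT hf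
  · rintro ⟨A, hA, hsome, henvy⟩
    choose f hf using fun a => Option.isSome_iff_exists.1 (hsome a)
    obtain rfl : A = fun a => some (f a) := funext hf
    have hinj : Function.Injective f := fun a b hab => hA a b (f b) (congrArg some hab) rfl
    obtain ⟨S, hcard, hS⟩ := exists_allocated f hinj
    rw [Fintype.card_sum, hE, Fintype.card_fin] at hcard
    refine ⟨S, by omega, ?_⟩
    intro x hx y hy
    obtain ⟨a, ha⟩ := hS x hx
    obtain ⟨b, hb⟩ := hS y hy
    exact not_adj_of_sum_envy_le_one G _ β f hinj henvy ha hb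

end Stmt13
end
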